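/- arXiv:2101.08421 — 3 statements merged into one kernel-verified Lean document; each statement's English description precedes it below -/
import Mathlib

section
/- Conversion of pairwise relation errors to Kendall's tau error (Lemma 4.1): Let n ≥ 1 and let R ∈ {0,1}^{n×n} satisfy R_ij + R_ji = 1 for all i ≠ j. Let r̂ ∈ 𝔖_n be the rank vector obtained by sorting the scores s_i = Σ_{j∈[n]\{i}} R_ij from high to low. For any r* ∈ 𝔖_n define its pairwise relation matrix R* by R*_ij = 1{r*_i < r*_j}. Then K(r̂, r*) ≤ (4/n) Σ_{1≤i≠j≤n} 1{R_ij ≠ R*_ij}. -/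
open Finset
open scoped Classical

noncomputable section

/-- Kendall's tau distance between two rank vectors. -/
def kendall (n : ℕ) (r s : Equiv.Perm (Fin n)) : ℝ :=
  (n : ℝ)⁻¹ * (Finset.univ.filter (fun q : Fin n × Fin n =>
    q.1 < q.2 ∧ ¬ ((r q.1 < r q.2) ↔ (s q.1 < s q.2)))).card

/-- The number of pairwise relation errors of `R` in row `i`. -/
def rowErrors {n : ℕ} (R : Fin n → Fin n → ℝ) (r : Equiv.Perm (Fin n)) (i : Fin n) : ℕ :=
  #{j | i ≠ j ∧ R i j ≠ (if r i < r j then (1 : ℝ) else 0)}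

lemma sum_rowErrors {n : ℕ} (R : Fin n → Fin n → ℝ) (r : Equiv.Perm (Fin n)) :
    ∑ i, rowErrors R r i = #{q : Fin n × Fin n |
      q.1 ≠ q.2 ∧ R q.1 q.2 ≠ (if r q.1 < r q.2 then (1 : ℝ) else 0)} := by
  simp only [rowErrors, Finset.card_filter]
  rw [Fintype.sum_prod_type]

/-- The score of an item under the true relation matrix is determined by its rank. -/
lemma sum_rank_indicator {n : ℕ} (r : Equiv.Perm (Fin n)) (i : Fin n) :
    ∑ k ∈ Finset.univ.erase i, (if r i < r k then (1 : ℝ) else 0) = n - 1 - (r i : ℕ) := by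
  have hcard : ∑ k, (if r i < r k then (1 : ℝ) else 0) = #(Finset.Ioi (r i)) := by
    rw [Equiv.sum_comp r (fun x => if r i < x then (1 : ℝ) else 0), Finset.sum_boole]
    congr 2
    ext x
    simp
  rw [Finset.sum_erase _ (by simp), hcard, Fin.card_Ioi]
  have := (r i).isLt
  rw [Nat.cast_sub (by omega), Nat.cast_sub (by omega)]
  simp

/-- A score differs from the true one by at most the number of errors in its row. -/
lemma abs_score_sub_le_rowErrors {n : ℕ} {R : Fin n → Fin n → ℝ}
    (hR01 : ∀ i j : Fin n, R i j = 0 ∨ R i j = 1) (r : Equiv.Perm (Fin n)) (i : Fin n) :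
    |∑ k ∈ Finset.univ.erase i, R i k - (n - 1 - (r i : ℕ))| ≤ rowErrors R r i := by
  have herr : (rowErrors R r i : ℝ) = ∑ k ∈ Finset.univ.erase i,
      (if R i k ≠ (if r i < r k then (1 : ℝ) else 0) then (1 : ℝ) else 0) := by
    rw [Finset.sum_boole, rowErrors]
    congr 2
    ext k
    simp [eq_comm]
  rw [← sum_rank_indicator r i, ← Finset.sum_sub_distrib, herr]
  refine (Finset.abs_sum_le_sum_abs _ _).trans (Finset.sum_le_sum fun k _ => ?_)
  rcases hR01 i k with h | h <;> by_cases hr : r i < r k <;> simp [h, hr]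

lemma card_near_le {n : ℕ} (r : Equiv.Perm (Fin n)) (a : Fin n) (m : ℕ) :
    #{b | b ≠ a ∧ |((r a : ℕ) : ℤ) - (r b : ℕ)| ≤ 2 * m} ≤ 4 * m := by
  have hcard : #((Finset.Icc (((r a : ℕ) : ℤ) - 2 * m) ((r a : ℕ) + 2 * m)).erase (r a : ℕ))
      = 4 * m := by
    rw [Finset.card_erase_of_mem (by simp), Int.card_Icc]
    omega
  rw [← hcard]
  refine Finset.card_le_card_of_injOn (fun b => ((r b : ℕ) : ℤ)) ?_ ?_
  · intro b hb
    simp only [Finset.coe_filter, Finset.mem_univ, true_and, Set.mem_ofPred_eq, abs_le] at hb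
    simp only [Finset.coe_erase, Finset.coe_Icc, Set.mem_sdiff, Set.mem_Icc, Set.mem_singleton_iff,
      Nat.cast_inj, Fin.val_inj, EmbeddingLike.apply_eq_iff_eq]
    exact ⟨by omega, hb.1⟩
  · intro b _ c _ h
    simpa [Fin.val_inj] using h

/-- If `rhat` puts `j` before `i` against the true order, the rank gap is covered by the errors in
the two rows. -/
lemma rank_gap_le_rowErrors {n : ℕ} {R : Fin n → Fin n → ℝ}
    (hR01 : ∀ i j : Fin n, R i j = 0 ∨ R i j = 1) (rhat r : Equiv.Perm (Fin n))
    (hsort : ∀ i j : Fin n,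
      (∑ k ∈ Finset.univ.erase j, R j k) < (∑ k ∈ Finset.univ.erase i, R i k) →
      rhat i < rhat j) {i j : Fin n} (h : ¬ rhat i < rhat j) :
    ((r j : ℕ) : ℤ) - (r i : ℕ) ≤ rowErrors R r i + rowErrors R r j := by
  have hs := not_lt.mp (mt (hsort i j) h)
  have hi := abs_le.mp (abs_score_sub_le_rowErrors hR01 r i)
  have hj := abs_le.mp (abs_score_sub_le_rowErrors hR01 r j)
  have : ((r j : ℕ) : ℝ) - (r i : ℕ) ≤ rowErrors R r i + rowErrors R r j := by
    linarith [hi.1, hj.2]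
  exact_mod_cast this

lemma abs_rank_gap_le_rowErrors {n : ℕ} {R : Fin n → Fin n → ℝ}
    (hR01 : ∀ i j : Fin n, R i j = 0 ∨ R i j = 1) (rhat r : Equiv.Perm (Fin n))
    (hsort : ∀ i j : Fin n,
      (∑ k ∈ Finset.univ.erase j, R j k) < (∑ k ∈ Finset.univ.erase i, R i k) →
      rhat i < rhat j) {i j : Fin n} (h : ¬ (rhat i < rhat j ↔ r i < r j)) :
    |((r i : ℕ) : ℤ) - (r j : ℕ)| ≤ rowErrors R r i + rowErrors R r j := by
  rw [abs_le]
  by_cases hlt : rhat i < rhat j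
  · have hgap := rank_gap_le_rowErrors hR01 rhat r hsort hlt.not_gt
    have hr : ¬ r i < r j := fun hr => h ⟨fun _ => hr, fun _ => hlt⟩
    rw [Fin.lt_def] at hr
    omega
  · have hgap := rank_gap_le_rowErrors hR01 rhat r hsort hlt
    have hr : r i < r j := by tauto
    rw [Fin.lt_def] at hr
    omega

lemma card_inversions_le {n : ℕ} {R : Fin n → Fin n → ℝ}
    (hR01 : ∀ i j : Fin n, R i j = 0 ∨ R i j = 1) (rhat r : Equiv.Perm (Fin n))
    (hsort : ∀ i j : Fin n,
      (∑ k ∈ Finset.univ.erase j, R j k) < (∑ k ∈ Finset.univ.erase i, R i k) →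
      rhat i < rhat j) :
    #{q : Fin n × Fin n | q.1 < q.2 ∧ ¬ (rhat q.1 < rhat q.2 ↔ r q.1 < r q.2)} ≤
      4 * ∑ i, rowErrors R r i := by
  let near : Finset (Fin n × Fin n) :=
    {q | q.2 ≠ q.1 ∧ |((r q.1 : ℕ) : ℤ) - (r q.2 : ℕ)| ≤ 2 * (rowErrors R r q.1 : ℕ)}
  have hnear : #near ≤ 4 * ∑ i, rowErrors R r i := by
    rw [Finset.mul_sum, Finset.card_filter, Fintype.sum_prod_type]
    refine Finset.sum_le_sum fun a _ => ?_
    rw [← Finset.card_filter]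
    convert card_near_le r a (rowErrors R r a)
  have mem_near (a b : Fin n) (hne : b ≠ a)
      (hle : |((r a : ℕ) : ℤ) - (r b : ℕ)| ≤ 2 * (rowErrors R r a : ℕ)) : (a, b) ∈ near :=
    Finset.mem_filter.mpr ⟨Finset.mem_univ _, hne, hle⟩
  clear_value near
  refine le_trans (Finset.card_le_card_of_injOn
    (fun q => if |((r q.1 : ℕ) : ℤ) - (r q.2 : ℕ)| ≤ 2 * (rowErrors R r q.1 : ℕ)
      then q else q.swap) ?_ ?_) hnear
  · rintro ⟨i, j⟩ hq
    simp only [Finset.coe_filter, Finset.mem_univ, true_and, Set.mem_ofPred_eq] at hq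
    have hgap := abs_rank_gap_le_rowErrors hR01 rhat r hsort hq.2
    dsimp only
    split_ifs with hle
    · exact mem_near i j hq.1.ne' hle
    · have hle' : |((r j : ℕ) : ℤ) - (r i : ℕ)| ≤ 2 * (rowErrors R r j : ℕ) := by
        rw [abs_sub_comm]
        omega
      exact mem_near j i hq.1.ne hle'
  · rintro ⟨i, j⟩ hq ⟨k, l⟩ hq' h
    simp only [Finset.coe_filter, Finset.mem_univ, true_and, Set.mem_ofPred_eq] at hq hq'
    have h₁ := hq.1
    have h₂ := hq'.1
    dsimp only at h
    split_ifs at h <;> simp only [Prod.swap_prod_mk, Prod.mk.injEq] at h ⊢ <;> omega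

/-- **Lemma 4.1**: if `R` is a {0,1}-valued pairwise relation matrix with
`R_ij + R_ji = 1` off the diagonal, and `rhat` sorts the scores
`s_i = Σ_{j≠i} R_ij` from high to low, then the Kendall tau error of `rhat`
is at most `4/n` times the number of pairwise relation errors. -/
theorem pairwise_relations_to_full_ranking
    (n : ℕ) (hn : 1 ≤ n)
    (R : Fin n → Fin n → ℝ)
    (hR01 : ∀ i j : Fin n, R i j = 0 ∨ R i j = 1)
    (hRsym : ∀ i j : Fin n, i ≠ j → R i j + R j i = 1)
    (rhat rstar : Equiv.Perm (Fin n))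
    (hsort : ∀ i j : Fin n,
      (∑ k ∈ Finset.univ.erase j, R j k) < (∑ k ∈ Finset.univ.erase i, R i k) →
      rhat i < rhat j) :
    kendall n rhat rstar ≤
      (4 / (n : ℝ)) * ((Finset.univ.filter (fun q : Fin n × Fin n =>
        q.1 ≠ q.2 ∧ R q.1 q.2 ≠ (if rstar q.1 < rstar q.2 then (1 : ℝ) else 0))).card) := by
  have hcount := card_inversions_le hR01 rhat rstar hsort
  rw [sum_rowErrors] at hcount
  rw [kendall, div_eq_inv_mul, mul_assoc]
  gcongr
  exact_mod_cast hcount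

end
end

section
/- Uniform bounds on sums of powers of the sigmoid derivative over the regular parameter space (Lemma 7.6): Fix constants α > 0 and C0 with 1 ≤ C0 = O(1). There exist constants C1, C2 > 0 such that for all sufficiently large n and all sufficiently small β > 0 (β = o(1)), and for every θ ∈ Θ_n(β, C0): C1 / (β ∨ 1/n) ≤ inf_{θ0 ∈ [θ_n, θ_1]} Σ_{i=1}^n ψ'(θ0 − θ_i)^α ≤ sup_{θ0 ∈ [θ_n, θ_1]} Σ_{i=1}^n ψ'(θ0 − θ_i)^α ≤ C2 / (β ∨ 1/n). -/
open Real Filter Finset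
open scoped Classical

noncomputable section

/-- The derivative of the sigmoid, ψ'(t) = e^t/(1+e^t)². -/
def sigmoidDeriv (t : ℝ) : ℝ := Real.exp t / (1 + Real.exp t) ^ 2

/-- The regular parameter space Θ_n(β, C0). -/
def regSpace (n : ℕ) (β C0 : ℝ) (θ : ℕ → ℝ) : Prop :=
  (∀ i j : ℕ, i ≤ j → j < n → θ j ≤ θ i) ∧
  (∀ i j : ℕ, i < n → j < n → i ≠ j →
    β * |(i : ℝ) - (j : ℝ)| ≤ |θ i - θ j| ∧ |θ i - θ j| ≤ C0 * (β * |(i : ℝ) - (j : ℝ)|))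

lemma sigmoidDeriv_pos (t : ℝ) : 0 < sigmoidDeriv t := by
  unfold sigmoidDeriv; positivity

lemma sigmoidDeriv_neg (t : ℝ) : sigmoidDeriv (-t) = sigmoidDeriv t := by
  have := Real.exp_pos t
  unfold sigmoidDeriv
  rw [Real.exp_neg]
  field_simp
  ring

lemma sigmoidDeriv_abs (t : ℝ) : sigmoidDeriv |t| = sigmoidDeriv t := by
  rcases abs_choice t with h | h <;> simp only [h, sigmoidDeriv_neg]

lemma sigmoidDeriv_le_exp_neg_abs (t : ℝ) : sigmoidDeriv t ≤ Real.exp (-|t|) := by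
  rw [← sigmoidDeriv_abs, sigmoidDeriv, Real.exp_neg, div_le_iff₀ (by positivity)]
  have h := Real.exp_pos |t|
  rw [inv_mul_eq_div, le_div_iff₀ h]
  nlinarith

lemma exp_neg_abs_div_four_le_sigmoidDeriv (t : ℝ) :
    Real.exp (-|t|) / 4 ≤ sigmoidDeriv t := by
  rw [← sigmoidDeriv_abs, sigmoidDeriv, Real.exp_neg, le_div_iff₀ (by positivity)]
  have h : 1 ≤ Real.exp |t| := Real.one_le_exp (abs_nonneg t)
  have h0 := Real.exp_pos |t|
  rw [div_mul_eq_mul_div, inv_mul_eq_div, div_div, div_le_iff₀ (by positivity)]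
  nlinarith

lemma sigmoidDeriv_rpow_le {α t s : ℝ} (hα : 0 ≤ α) (h : s ≤ |t|) :
    sigmoidDeriv t ^ α ≤ Real.exp (-(α * s)) := by
  calc sigmoidDeriv t ^ α ≤ Real.exp (-|t|) ^ α :=
        Real.rpow_le_rpow (sigmoidDeriv_pos t).le (sigmoidDeriv_le_exp_neg_abs t) hα
    _ = Real.exp (-|t| * α) := (Real.exp_mul _ _).symm
    _ ≤ Real.exp (-(α * s)) := Real.exp_le_exp.2 (by nlinarith)

lemma le_sigmoidDeriv_rpow {α t s : ℝ} (hα : 0 ≤ α) (h : |t| ≤ s) :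
    (Real.exp (-s) / 4) ^ α ≤ sigmoidDeriv t ^ α := by
  refine Real.rpow_le_rpow (by positivity) (le_trans ?_ (exp_neg_abs_div_four_le_sigmoidDeriv t)) hα
  gcongr

/-- A point of `[θ (n - 1), θ 0]` lies in a cell `[θ (k + 1), θ k]` of the grid (or equals the last
grid point when `k = n - 1`). -/
lemma exists_grid_cell {n : ℕ} (hn : 0 < n) {θ : ℕ → ℝ} {θ0 : ℝ}
    (hlo : θ (n - 1) ≤ θ0) (hhi : θ0 ≤ θ 0) :
    ∃ k < n, θ0 ≤ θ k ∧ (k + 1 < n → θ (k + 1) ≤ θ0) ∧ (k + 1 = n → θ0 = θ k) := by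
  have hspec : θ0 ≤ θ (Nat.findGreatest (fun k => θ0 ≤ θ k) (n - 1)) :=
    Nat.findGreatest_spec (P := fun k => θ0 ≤ θ k) (Nat.zero_le (n - 1)) hhi
  have hle := Nat.findGreatest_le (P := fun k => θ0 ≤ θ k) (n - 1)
  refine ⟨Nat.findGreatest (fun k => θ0 ≤ θ k) (n - 1), by omega, hspec, fun h => ?_, fun h => ?_⟩
  · exact (not_le.1 (Nat.findGreatest_is_greatest (P := fun k => θ0 ≤ θ k)
      (Nat.lt_succ_self _) (by omega))).le
  · refine le_antisymm hspec ?_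
    rwa [show Nat.findGreatest (fun k => θ0 ≤ θ k) (n - 1) = n - 1 by omega]

lemma regSpace.mul_sub_le {n : ℕ} {b C0 : ℝ} {θ : ℕ → ℝ} (h : regSpace n b C0 θ)
    {i j : ℕ} (hij : i ≤ j) (hj : j < n) : b * ((j : ℝ) - i) ≤ θ i - θ j := by
  rcases hij.eq_or_lt with rfl | hlt
  · simp
  · have h1 := (h.2 i j (by omega) hj hlt.ne).1
    have h2 : (i : ℝ) ≤ j := by exact_mod_cast hij
    rwa [abs_of_nonneg (sub_nonneg.2 (h.1 i j hij hj)), abs_sub_comm,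
      abs_of_nonneg (sub_nonneg.2 h2)] at h1

lemma regSpace.abs_sub_le {n : ℕ} {b C0 : ℝ} {θ : ℕ → ℝ} (h : regSpace n b C0 θ)
    {i j : ℕ} (hi : i < n) (hj : j < n) : |θ i - θ j| ≤ C0 * (b * |(i : ℝ) - j|) := by
  rcases eq_or_ne i j with rfl | hne
  · simp
  · exact (h.2 i j hi hj hne).2

lemma sum_exp_neg_mul_le {α b : ℝ} (hα : 0 < α) (hb : 0 < b) (hb1 : b ≤ 1) (m : ℕ) :
    ∑ j ∈ Finset.range m, Real.exp (-(α * (b * j))) ≤ (1 + α) / α / b := by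
  have hx : 0 < α * b := mul_pos hα hb
  set q := Real.exp (-(α * b)) with hq
  have hq0 : 0 < q := Real.exp_pos _
  have hq1 : q < 1 := by
    rw [hq, ← Real.exp_zero]; exact Real.exp_lt_exp.2 (by linarith)
  have hqle : q * (1 + α * b) ≤ 1 := by
    have h1 : α * b + 1 ≤ Real.exp (α * b) := Real.add_one_le_exp _
    calc q * (1 + α * b) ≤ q * Real.exp (α * b) := by gcongr; linarith
      _ = 1 := by rw [hq, ← Real.exp_add]; simp
  have hterm : ∀ j : ℕ, Real.exp (-(α * (b * j))) = q ^ j := fun j => by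
    rw [hq, ← Real.exp_nat_mul]; congr 1; ring
  simp only [hterm]
  rw [geom_sum_eq hq1.ne, ← neg_div_neg_eq, div_div, div_le_div_iff₀ (by linarith) hx]
  have hqm : 0 ≤ q ^ m := by positivity
  have key : α * b ≤ (1 + α) * (1 - q) := by
    have : α * b ≤ (1 + α * b) * (1 - q) := by linarith
    refine this.trans ?_
    have h1q : 0 ≤ 1 - q := by linarith
    gcongr
    exact mul_le_of_le_one_right hα.le hb1
  nlinarith

lemma sum_sigmoidDeriv_rpow_le {n : ℕ} (hn : 0 < n) {α b C0 : ℝ} (hα : 0 < α)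
    (hb : 0 < b) (hb1 : b ≤ 1) {θ : ℕ → ℝ} (h : regSpace n b C0 θ) {θ0 : ℝ}
    (hlo : θ (n - 1) ≤ θ0) (hhi : θ0 ≤ θ 0) :
    ∑ i ∈ Finset.range n, sigmoidDeriv (θ0 - θ i) ^ α ≤ 2 * ((1 + α) / α) / b := by
  obtain ⟨k, hk, hk1, hk2, -⟩ := exists_grid_cell hn hlo hhi
  obtain ⟨m, rfl⟩ := Nat.exists_eq_add_of_le (Nat.succ_le_of_lt hk)
  rw [Finset.sum_range_add, ← Finset.sum_range_reflect]
  have h1 : ∑ j ∈ Finset.range k.succ, sigmoidDeriv (θ0 - θ (k.succ - 1 - j)) ^ α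
      ≤ (1 + α) / α / b := by
    refine (Finset.sum_le_sum fun j hj => ?_).trans (sum_exp_neg_mul_le hα hb hb1 k.succ)
    have hjk : j ≤ k := Nat.lt_succ_iff.1 (Finset.mem_range.1 hj)
    refine sigmoidDeriv_rpow_le hα.le ?_
    have h3 := h.mul_sub_le (Nat.sub_le k j) hk
    rw [Nat.cast_sub hjk] at h3
    rw [Nat.succ_sub_one, abs_sub_comm]
    refine le_trans ?_ (le_abs_self _)
    linarith
  have h2 : ∑ j ∈ Finset.range m, sigmoidDeriv (θ0 - θ (k.succ + j)) ^ α
      ≤ (1 + α) / α / b := by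
    refine (Finset.sum_le_sum fun j hj => ?_).trans (sum_exp_neg_mul_le hα hb hb1 m)
    have hjm := Finset.mem_range.1 hj
    refine sigmoidDeriv_rpow_le hα.le ?_
    have h3 := h.mul_sub_le (Nat.le_add_right k.succ j) (by omega)
    have h4 := hk2 (by omega)
    push_cast at h3
    refine le_trans ?_ (le_abs_self _)
    simp only [Nat.succ_eq_add_one] at h3 ⊢
    linarith
  calc _ ≤ (1 + α) / α / b + (1 + α) / α / b := add_le_add h1 h2
    _ = _ := by ring

lemma sum_sigmoidDeriv_rpow_le_card {α : ℝ} (hα : 0 < α) (n : ℕ) (f : ℕ → ℝ) :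
    ∑ i ∈ Finset.range n, sigmoidDeriv (f i) ^ α ≤ n := by
  calc _ ≤ ∑ _i ∈ Finset.range n, (1 : ℝ) := Finset.sum_le_sum fun i _ => by
        simpa using sigmoidDeriv_rpow_le hα.le (abs_nonneg (f i))
    _ = n := by simp

lemma le_sum_sigmoidDeriv_rpow {n : ℕ} (hn : 0 < n) {α b C0 : ℝ} (hα : 0 < α) (hC0 : 0 ≤ C0)
    (hb : 0 < b) (hb1 : b ≤ 1) {θ : ℕ → ℝ} (h : regSpace n b C0 θ) {θ0 : ℝ}
    (hlo : θ (n - 1) ≤ θ0) (hhi : θ0 ≤ θ 0) :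
    (Real.exp (-(2 * C0)) / 4) ^ α / 2 / max b (n : ℝ)⁻¹
      ≤ ∑ i ∈ Finset.range n, sigmoidDeriv (θ0 - θ i) ^ α := by
  obtain ⟨k, hk, hk1, hk2, hk3⟩ := exists_grid_cell hn hlo hhi
  have hdist : |θ0 - θ k| ≤ C0 * b := by
    rcases (Nat.succ_le_of_lt hk).lt_or_eq with hlt | heq
    · have h1 := h.abs_sub_le hk hlt
      have h2 := hk2 hlt
      simp only [Nat.succ_eq_add_one, Nat.cast_add, Nat.cast_one, sub_add_cancel_left, abs_neg,
        abs_one, mul_one] at h1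
      rw [abs_sub_comm, abs_of_nonneg (by linarith)]
      linarith [le_abs_self (θ k - θ (k + 1))]
    · rw [hk3 heq, sub_self, abs_zero]
      positivity
  set M := max b (n : ℝ)⁻¹ with hM
  have hbM : b ≤ M := le_max_left _ _
  have hM0 : 0 < M := hb.trans_le hbM
  have hnM : 1 / M ≤ n := by
    rw [one_div]
    exact inv_le_of_inv_le₀ (by exact_mod_cast hn) (le_max_right _ _)
  set m := ⌈1 / M / 2⌉₊ with hm
  have hm1 : 1 / M / 2 ≤ m := Nat.le_ceil _
  have hm2 : (m : ℝ) < 1 / M / 2 + 1 := Nat.ceil_lt_add_one (by positivity)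
  have hmn : 2 * m < n + 2 := by
    have : (2 * m : ℝ) < n + 2 := by linarith
    exact_mod_cast this
  have hmb : b * m ≤ 1 / 2 + b := by
    have h1 : b * (1 / M) ≤ 1 := by
      rw [mul_one_div]; exact (div_le_one hM0).2 hbM
    nlinarith
  obtain ⟨a, han, hwin⟩ : ∃ a, a + m ≤ n ∧
      ∀ i, a ≤ i → i < a + m → i + 1 ≤ k + m ∧ k + 1 ≤ i + m := by
    by_cases hc : k + m ≤ n
    · exact ⟨k, hc, fun i _ _ => by omega⟩
    · exact ⟨k + 1 - m, by omega, fun i _ _ => by omega⟩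
  have hterm : ∀ i ∈ Finset.Ico a (a + m),
      (Real.exp (-(2 * C0)) / 4) ^ α ≤ sigmoidDeriv (θ0 - θ i) ^ α := by
    intro i hi
    rw [Finset.mem_Ico] at hi
    refine le_sigmoidDeriv_rpow hα.le ?_
    obtain ⟨h1, h2⟩ := hwin i hi.1 hi.2
    have h3 : |(k : ℝ) - i| ≤ m - 1 := by
      have h1' : (i : ℝ) + 1 ≤ k + m := by exact_mod_cast h1
      have h2' : (k : ℝ) + 1 ≤ i + m := by exact_mod_cast h2
      rw [abs_le]
      constructor <;> linarith
    calc |θ0 - θ i| ≤ |θ0 - θ k| + |θ k - θ i| := abs_sub_le _ _ _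
      _ ≤ C0 * b + C0 * (b * (m - 1)) := by
          refine add_le_add hdist ((h.abs_sub_le hk (by omega)).trans ?_)
          gcongr
      _ = C0 * (b * m) := by ring
      _ ≤ C0 * 2 := by gcongr; linarith
      _ = 2 * C0 := mul_comm _ _
  calc (Real.exp (-(2 * C0)) / 4) ^ α / 2 / M = 1 / M / 2 * (Real.exp (-(2 * C0)) / 4) ^ α := by ring
    _ ≤ m * (Real.exp (-(2 * C0)) / 4) ^ α := by gcongr
    _ ≤ ∑ i ∈ Finset.Ico a (a + m), sigmoidDeriv (θ0 - θ i) ^ α := by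
        simpa using Finset.card_nsmul_le_sum _ _ _ hterm
    _ ≤ _ := Finset.sum_le_sum_of_subset_of_nonneg
        (fun i hi => by rw [Finset.mem_Ico] at hi; exact Finset.mem_range.2 (by omega))
        fun i _ _ => (Real.rpow_pos_of_pos (sigmoidDeriv_pos _) _).le

/-- **Lemma 7.6**: uniform two-sided bounds on Σ_{i} ψ'(θ0 − θ_i)^α for θ0 ranging
over [θ_n, θ_1], of order 1/(β ∨ 1/n), uniformly over the regular parameter space. -/
theorem sum_sigmoid_deriv_pow_bounds
    (α C0 : ℝ) (hα : 0 < α) (hC0 : 1 ≤ C0)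
    (β : ℕ → ℝ) (hβpos : ∀ n, 0 < β n) (hβ0 : Tendsto β atTop (nhds 0)) :
    ∃ C1 C2 : ℝ, 0 < C1 ∧ 0 < C2 ∧ ∃ N : ℕ, ∀ n : ℕ, N ≤ n →
      ∀ θ : ℕ → ℝ, regSpace n (β n) C0 θ →
      ∀ θ0 : ℝ, θ (n - 1) ≤ θ0 → θ0 ≤ θ 0 →
        C1 / max (β n) ((n : ℝ)⁻¹)
            ≤ ∑ i ∈ Finset.range n, sigmoidDeriv (θ0 - θ i) ^ α ∧
        ∑ i ∈ Finset.range n, sigmoidDeriv (θ0 - θ i) ^ α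
            ≤ C2 / max (β n) ((n : ℝ)⁻¹) := by
  obtain ⟨N, hN⟩ := eventually_atTop.1 (hβ0.eventually (ge_mem_nhds zero_lt_one))
  refine ⟨(Real.exp (-(2 * C0)) / 4) ^ α / 2, max 1 (2 * ((1 + α) / α)), by positivity,
    by positivity, max N 1, fun n hn θ h θ0 hlo hhi => ?_⟩
  have hn0 : 0 < n := (le_max_right N 1).trans hn
  have hb := hβpos n
  have hb1 : β n ≤ 1 := hN n ((le_max_left N 1).trans hn)
  refine ⟨le_sum_sigmoidDeriv_rpow hn0 hα (by linarith) hb hb1 h hlo hhi, ?_⟩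
  rcases max_choice (β n) (n : ℝ)⁻¹ with hm | hm <;> rw [hm]
  · refine (sum_sigmoidDeriv_rpow_le hn0 hα hb hb1 h hlo hhi).trans ?_
    gcongr
    exact le_max_right _ _
  · refine (sum_sigmoidDeriv_rpow_le_card hα n fun i => θ0 - θ i).trans ?_
    rw [div_inv_eq_mul]
    exact le_mul_of_one_le_left (Nat.cast_nonneg n) (le_max_left _ _)

end
end

section
/- Deterministic properties of the function G (Lemma 7.8): Assume 1 ≤ C0 = O(1) and 0 < β = o(1). For any constant C > 0 there exist constants C1, C2, C3 > 0 such that for all sufficiently large n, any θ ∈ Θ_n(β, C0), any r ∈ 𝔖_n, and any distinct i, j ∈ [n] with |θ_{r_i} − θ_{r_j}| ≤ C, the following hold: (a) sup_{u∈[0,1]} sup_{k≠i,j} G_{i,j,k,θ,r}(u) ≤ C1; (b) sup_{u∈[0,1]} Σ_{k≠i,j} [G_{i,j,k,θ,r}(u) + G_{i,j,k,θ,r}(1−u)] ≤ Σ_{k≠i,j} log[(1+e^{θ_{r_i}−θ_{r_k}})(1+e^{θ_{r_j}−θ_{r_k}}) / (1+e^{(θ_{r_i}+θ_{r_j})/2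 − θ_{r_k}})²]; (c) sup_{u∈[0,1]} Σ_{k≠i,j} [G_{i,j,k,θ,r}(u)² + G_{i,j,k,θ,r}(1−u)²] ≤ C2 (θ_{r_i} − θ_{r_j})⁴ / (β ∨ 1/n); (d) C3 |θ_{r_i} − θ_{r_j}|² / (β ∨ 1/n) ≤ Σ_{k≠i,j} log[(1+e^{θ_{r_i}−θ_{r_k}})(1+e^{θ_{r_j}−θ_{r_k}}) / (1+e^{(θ_{r_i}+θ_{r_j})/2 − θ_{r_k}})²] ≤ C2 |θ_{r_i} − θ_{r_j}|² / (β ∨ 1/n). -/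
open Real Filter Finset
open scoped Classical

noncomputable section

/-- The function G_{i,j,k,θ,r}(u) from the paper. -/
def Gfun (n : ℕ) (θ : ℕ → ℝ) (r : Equiv.Perm (Fin n)) (i j k : Fin n) (u : ℝ) : ℝ :=
  Real.log ((1 + Real.exp (θ ((r i : ℕ)) - θ ((r k : ℕ)))) ^ u
      * (1 + Real.exp (θ ((r j : ℕ)) - θ ((r k : ℕ)))) ^ (1 - u)
    / (1 + Real.exp (u * θ ((r i : ℕ)) + (1 - u) * θ ((r j : ℕ)) - θ ((r k : ℕ)))))

/-- The summand log[(1+e^{θ_{r_i}−θ_{r_k}})(1+e^{θ_{r_j}−θ_{r_k}})/(1+e^{(θ_{r_i}+θ_{r_j})/2−θ_{r_k}})²]. -/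
def logRatio (n : ℕ) (θ : ℕ → ℝ) (r : Equiv.Perm (Fin n)) (i j k : Fin n) : ℝ :=
  Real.log ((1 + Real.exp (θ ((r i : ℕ)) - θ ((r k : ℕ))))
      * (1 + Real.exp (θ ((r j : ℕ)) - θ ((r k : ℕ))))
    / (1 + Real.exp ((θ ((r i : ℕ)) + θ ((r j : ℕ))) / 2 - θ ((r k : ℕ)))) ^ 2)

/-- The softplus function `x ↦ log (1 + e ^ x)`. -/
def softplus (x : ℝ) : ℝ := Real.log (1 + Real.exp x)

lemma hasDerivAt_softplus (x : ℝ) :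
    HasDerivAt softplus (Real.exp x / (1 + Real.exp x)) x :=
  ((Real.hasDerivAt_exp x).const_add 1).log (by positivity)

lemma convexOn_softplus : ConvexOn ℝ Set.univ softplus := by
  refine Monotone.convexOn_univ_of_deriv (fun x => (hasDerivAt_softplus x).differentiableAt) ?_
  intro x y hxy
  rw [(hasDerivAt_softplus x).deriv, (hasDerivAt_softplus y).deriv,
    div_le_div_iff₀ (by positivity) (by positivity)]
  have := Real.exp_le_exp.2 hxy
  nlinarith

lemma softplus_le_add_abs (x y : ℝ) : softplus x ≤ softplus y + |x - y| := by
  unfold softplus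
  rw [← Real.log_exp |x - y|, ← Real.log_mul (by positivity) (by positivity)]
  apply Real.log_le_log (by positivity)
  have h1 : 1 ≤ Real.exp |x - y| := Real.one_le_exp (abs_nonneg _)
  have h2 : Real.exp x ≤ Real.exp y * Real.exp |x - y| := by
    rw [← Real.exp_add]
    exact Real.exp_le_exp.2 (by linarith [le_abs_self (x - y)])
  linarith

lemma log_one_add_exp_mul_div_sq (a b : ℝ) :
    Real.log ((1 + Real.exp a) * (1 + Real.exp b) / (1 + Real.exp ((a + b) / 2)) ^ 2) =
      softplus a + softplus b - 2 * softplus ((a + b) / 2) := by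
  rw [Real.log_div (by positivity) (by positivity), Real.log_mul (by positivity) (by positivity),
    Real.log_pow]
  simp [softplus]

/-- Twice the midpoint convexity gap of `softplus`, in closed form. -/
lemma softplus_gap_eq (a b : ℝ) :
    softplus a + softplus b - 2 * softplus ((a + b) / 2) =
      Real.log (1 + 4 * Real.sinh ((a - b) / 4) ^ 2 *
        (Real.exp ((a + b) / 2) / (1 + Real.exp ((a + b) / 2)) ^ 2)) := by
  rw [← log_one_add_exp_mul_div_sq]
  congr 1
  have ha : Real.exp a = Real.exp ((a + b) / 2) * Real.exp ((a - b) / 4) ^ 2 := by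
    rw [← Real.exp_nat_mul, ← Real.exp_add]; congr 1; push_cast; ring
  have hb : Real.exp b = Real.exp ((a + b) / 2) * Real.exp (-((a - b) / 4)) ^ 2 := by
    rw [← Real.exp_nat_mul, ← Real.exp_add]; congr 1; push_cast; ring
  have h1 : Real.exp ((a - b) / 4) * Real.exp (-((a - b) / 4)) = 1 := by
    rw [← Real.exp_add]; simp
  rw [ha, hb, Real.sinh_eq]
  have hM := Real.exp_pos ((a + b) / 2)
  generalize Real.exp ((a + b) / 2) = M at *
  generalize Real.exp ((a - b) / 4) = x at *
  generalize Real.exp (-((a - b) / 4)) = y at *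
  field_simp
  linear_combination 4 * (M ^ 2 * (x * y + 1) + 2 * M) * h1

lemma exp_div_one_add_exp_sq_le (m : ℝ) :
    Real.exp m / (1 + Real.exp m) ^ 2 ≤ Real.exp (-|m|) := by
  have hM := Real.exp_pos m
  rw [div_le_iff₀ (by positivity)]
  rcases abs_cases m with ⟨h, _⟩ | ⟨h, _⟩ <;> rw [h]
  · rw [Real.exp_neg, inv_mul_eq_div, le_div_iff₀ hM]
    nlinarith
  · rw [neg_neg]
    nlinarith [mul_pos hM hM]

lemma le_exp_div_one_add_exp_sq (m : ℝ) :
    Real.exp (-|m|) / 4 ≤ Real.exp m / (1 + Real.exp m) ^ 2 := by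
  have hM := Real.exp_pos m
  rw [div_le_div_iff₀ (by positivity) (by positivity)]
  rcases abs_cases m with ⟨h, h0⟩ | ⟨h, h0⟩ <;> rw [h]
  · have h1 : 1 ≤ Real.exp m := Real.one_le_exp h0
    rw [Real.exp_neg, inv_mul_eq_div, div_le_iff₀ hM]
    nlinarith
  · have h1 : Real.exp m ≤ 1 := Real.exp_le_one_iff.2 h0.le
    rw [neg_neg]
    have : (1 + Real.exp m) ^ 2 ≤ 4 := by nlinarith
    nlinarith

lemma abs_sinh_le_mul_exp (t : ℝ) : |Real.sinh t| ≤ |t| * Real.exp |t| := by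
  rw [Real.abs_sinh, Real.sinh_eq]
  have h0 := abs_nonneg t
  generalize |t| = s at *
  have h1 : 1 - 2 * s ≤ Real.exp (-(2 * s)) := by linarith [Real.add_one_le_exp (-(2 * s))]
  have h2 : Real.exp (-s) = Real.exp s * Real.exp (-(2 * s)) := by
    rw [← Real.exp_add]; congr 1; ring
  rw [h2]
  nlinarith [Real.exp_pos s]

lemma abs_le_abs_sinh (t : ℝ) : |t| ≤ |Real.sinh t| := by
  rw [Real.abs_sinh]
  exact Real.self_le_sinh_iff.2 (abs_nonneg t)

lemma sinh_sq_le {t C : ℝ} (h : |t| ≤ C) : Real.sinh t ^ 2 ≤ t ^ 2 * Real.exp (2 * C) := by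
  have h1 := abs_sinh_le_mul_exp t
  have h2 : |t| * Real.exp |t| ≤ |t| * Real.exp C := by gcongr
  have h3 : Real.exp (2 * C) = Real.exp C ^ 2 := by rw [← Real.exp_nat_mul]; norm_num
  rw [h3, ← mul_pow, sq_le_sq, abs_mul, abs_of_pos (Real.exp_pos C)]
  exact h1.trans h2

lemma softplus_gap_nonneg (a b : ℝ) :
    0 ≤ softplus a + softplus b - 2 * softplus ((a + b) / 2) := by
  rw [softplus_gap_eq]
  apply Real.log_nonneg
  have : 0 ≤ 4 * Real.sinh ((a - b) / 4) ^ 2 *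
      (Real.exp ((a + b) / 2) / (1 + Real.exp ((a + b) / 2)) ^ 2) := by positivity
  linarith

lemma softplus_gap_le {a b C : ℝ} (h : |a - b| ≤ C) :
    softplus a + softplus b - 2 * softplus ((a + b) / 2) ≤
      Real.exp C * (a - b) ^ 2 * Real.exp (-|(a + b) / 2|) := by
  rw [softplus_gap_eq]
  have h1 := exp_div_one_add_exp_sq_le ((a + b) / 2)
  have h2 : Real.sinh ((a - b) / 4) ^ 2 ≤ ((a - b) / 4) ^ 2 * Real.exp (2 * (C / 4)) :=
    sinh_sq_le (by rw [abs_div]; norm_num; linarith)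
  have h3 : Real.exp (2 * (C / 4)) ≤ Real.exp C :=
    Real.exp_le_exp.2 (by linarith [abs_nonneg (a - b)])
  have h4 : 0 ≤ Real.exp ((a + b) / 2) / (1 + Real.exp ((a + b) / 2)) ^ 2 := by positivity
  have h5 : 4 * Real.sinh ((a - b) / 4) ^ 2 ≤ Real.exp C * (a - b) ^ 2 := by
    have := mul_le_mul_of_nonneg_left h3 (sq_nonneg ((a - b) / 4))
    nlinarith [mul_nonneg (Real.exp_pos C).le (sq_nonneg (a - b))]
  have h6 := mul_le_mul h5 h1 h4 (by positivity)
  have h7 : 0 ≤ 4 * Real.sinh ((a - b) / 4) ^ 2 *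
      (Real.exp ((a + b) / 2) / (1 + Real.exp ((a + b) / 2)) ^ 2) := by positivity
  linarith [Real.log_le_sub_one_of_pos (show 0 < 1 + 4 * Real.sinh ((a - b) / 4) ^ 2 *
      (Real.exp ((a + b) / 2) / (1 + Real.exp ((a + b) / 2)) ^ 2) by linarith)]

lemma le_softplus_gap {a b C : ℝ} (h : |a - b| ≤ C) :
    (a - b) ^ 2 * Real.exp (-|(a + b) / 2|) / (16 * (4 * (1 + Real.exp C * C ^ 2))) ≤
      softplus a + softplus b - 2 * softplus ((a + b) / 2) := by
  rw [softplus_gap_eq]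
  have h0 := le_exp_div_one_add_exp_sq ((a + b) / 2)
  have h1 := exp_div_one_add_exp_sq_le ((a + b) / 2)
  have hE : Real.exp (-|(a + b) / 2|) ≤ 1 := Real.exp_le_one_iff.2 (by simp)
  have hab : (a - b) ^ 2 ≤ C ^ 2 := by
    rw [← sq_abs]; gcongr
  have h2 : Real.sinh ((a - b) / 4) ^ 2 ≤ ((a - b) / 4) ^ 2 * Real.exp (2 * (C / 4)) :=
    sinh_sq_le (by rw [abs_div]; norm_num; linarith)
  have h3 : Real.exp (2 * (C / 4)) ≤ Real.exp C :=
    Real.exp_le_exp.2 (by linarith [abs_nonneg (a - b)])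
  have h4 : 4 * Real.sinh ((a - b) / 4) ^ 2 ≤ Real.exp C * C ^ 2 := by
    have := mul_le_mul_of_nonneg_left h3 (sq_nonneg ((a - b) / 4))
    have := mul_le_mul_of_nonneg_left hab (Real.exp_pos C).le
    nlinarith [mul_nonneg (Real.exp_pos C).le (sq_nonneg (a - b))]
  have h5 : ((a - b) / 4) ^ 2 ≤ Real.sinh ((a - b) / 4) ^ 2 := sq_le_sq.2 (abs_le_abs_sinh _)
  set q := Real.exp ((a + b) / 2) / (1 + Real.exp ((a + b) / 2)) ^ 2 with hq
  have hq0 : 0 ≤ q := by positivity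
  set S := 4 * Real.sinh ((a - b) / 4) ^ 2 with hS
  have hS0 : 0 ≤ S := by positivity
  have hK : 0 < 1 + Real.exp C * C ^ 2 := by positivity
  have hx0 : 0 ≤ S * q := mul_nonneg hS0 hq0
  have hxK : S * q ≤ Real.exp C * C ^ 2 := by nlinarith
  have hlog := Real.one_sub_inv_le_log_of_pos (show 0 < 1 + S * q by linarith)
  refine le_trans ?_ hlog
  have hrw : 1 - (1 + S * q)⁻¹ = S * q / (1 + S * q) := by field_simp; ring
  rw [hrw]
  have hnum : (a - b) ^ 2 * Real.exp (-|(a + b) / 2|) / (16 * 4) ≤ S * q := by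
    have := mul_le_mul (show (a - b) ^ 2 / 16 ≤ S by nlinarith) h0 (by positivity) hS0
    linarith
  calc _ = (a - b) ^ 2 * Real.exp (-|(a + b) / 2|) / (16 * 4) / (1 + Real.exp C * C ^ 2) := by
        field_simp
    _ ≤ S * q / (1 + S * q) := by
        gcongr

/-! ### The convexity gaps in terms of `softplus` -/

lemma Gfun_eq (n : ℕ) (θ : ℕ → ℝ) (r : Equiv.Perm (Fin n)) (i j k : Fin n) (u : ℝ) :
    Gfun n θ r i j k u = u * softplus (θ (r i) - θ (r k)) +
      (1 - u) * softplus (θ (r j) - θ (r k)) -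
      softplus (u * (θ (r i) - θ (r k)) + (1 - u) * (θ (r j) - θ (r k))) := by
  unfold Gfun softplus
  rw [Real.log_div (by positivity) (by positivity), Real.log_mul (by positivity) (by positivity),
    Real.log_rpow (by positivity), Real.log_rpow (by positivity)]
  ring_nf

lemma logRatio_eq (n : ℕ) (θ : ℕ → ℝ) (r : Equiv.Perm (Fin n)) (i j k : Fin n) :
    logRatio n θ r i j k = softplus (θ (r i) - θ (r k)) + softplus (θ (r j) - θ (r k)) -
      2 * softplus ((θ (r i) - θ (r k) + (θ (r j) - θ (r k))) / 2) := by
  rw [← log_one_add_exp_mul_div_sq]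
  unfold logRatio
  congr 5
  ring

lemma logRatio_nonneg (n : ℕ) (θ : ℕ → ℝ) (r : Equiv.Perm (Fin n)) (i j k : Fin n) :
    0 ≤ logRatio n θ r i j k := by
  rw [logRatio_eq]
  exact softplus_gap_nonneg _ _

lemma Gfun_nonneg (n : ℕ) (θ : ℕ → ℝ) (r : Equiv.Perm (Fin n)) (i j k : Fin n) {u : ℝ}
    (hu : u ∈ Set.Icc (0 : ℝ) 1) : 0 ≤ Gfun n θ r i j k u := by
  rw [Gfun_eq]
  have := convexOn_softplus.2 (Set.mem_univ (θ (r i) - θ (r k)))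
    (Set.mem_univ (θ (r j) - θ (r k))) hu.1 (sub_nonneg.2 hu.2) (by ring)
  simp only [smul_eq_mul] at this
  linarith

lemma Gfun_le_abs_sub (n : ℕ) (θ : ℕ → ℝ) (r : Equiv.Perm (Fin n)) (i j k : Fin n) {u : ℝ}
    (hu : u ∈ Set.Icc (0 : ℝ) 1) : Gfun n θ r i j k u ≤ |θ (r i) - θ (r j)| := by
  rw [Gfun_eq]
  obtain ⟨hu0, hu1⟩ := hu
  set a := θ (r i) - θ (r k)
  set b := θ (r j) - θ (r k)
  have hab : θ (r i) - θ (r j) = a - b := by simp only [a, b]; ring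
  rw [hab]
  have h1 := softplus_le_add_abs a (u * a + (1 - u) * b)
  have h2 := softplus_le_add_abs b (u * a + (1 - u) * b)
  have e1 : |a - (u * a + (1 - u) * b)| = (1 - u) * |a - b| := by
    rw [← abs_of_nonneg (sub_nonneg.2 hu1), ← abs_mul, abs_of_nonneg (sub_nonneg.2 hu1)]
    ring_nf
  have e2 : |b - (u * a + (1 - u) * b)| = u * |a - b| := by
    rw [abs_sub_comm a b, ← abs_of_nonneg hu0, ← abs_mul, abs_of_nonneg hu0]
    ring_nf
  rw [e1] at h1
  rw [e2] at h2
  nlinarith [mul_le_mul_of_nonneg_left h1 hu0, mul_le_mul_of_nonneg_left h2 (sub_nonneg.2 hu1),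
    mul_nonneg (abs_nonneg (a - b)) (sq_nonneg (1 - 2 * u)), abs_nonneg (a - b)]

lemma Gfun_add_Gfun_one_sub_le (n : ℕ) (θ : ℕ → ℝ) (r : Equiv.Perm (Fin n)) (i j k : Fin n)
    (u : ℝ) : Gfun n θ r i j k u + Gfun n θ r i j k (1 - u) ≤ logRatio n θ r i j k := by
  rw [Gfun_eq, Gfun_eq, logRatio_eq]
  set a := θ (r i) - θ (r k)
  set b := θ (r j) - θ (r k)
  have := softplus_gap_nonneg (u * a + (1 - u) * b) ((1 - u) * a + (1 - (1 - u)) * b)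
  rw [show u * a + (1 - u) * b + ((1 - u) * a + (1 - (1 - u)) * b) = a + b by ring] at this
  linarith

lemma Gfun_sq_add_sq_le (n : ℕ) (θ : ℕ → ℝ) (r : Equiv.Perm (Fin n)) (i j k : Fin n) {u : ℝ}
    (hu : u ∈ Set.Icc (0 : ℝ) 1) :
    Gfun n θ r i j k u ^ 2 + Gfun n θ r i j k (1 - u) ^ 2 ≤ logRatio n θ r i j k ^ 2 := by
  have h1 := Gfun_nonneg n θ r i j k hu
  have h2 : 0 ≤ Gfun n θ r i j k (1 - u) :=
    Gfun_nonneg n θ r i j k ⟨sub_nonneg.2 hu.2, by linarith [hu.1]⟩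
  have h3 := Gfun_add_Gfun_one_sub_le n θ r i j k u
  nlinarith [mul_nonneg h1 h2]

/-! ### Sums over the index set -/

lemma sum_pow_le_inv_one_sub {x : ℝ} (h0 : 0 ≤ x) (h1 : x < 1) (m : ℕ) :
    ∑ k ∈ range m, x ^ k ≤ (1 - x)⁻¹ := by
  rw [← tsum_geometric_of_lt_one h0 h1]
  exact (summable_geometric_of_lt_one h0 h1).sum_le_tsum _ (fun _ _ => by positivity)

lemma sum_exp_neg_mul_abs_sub_le {β : ℝ} (hβ : 0 < β) (hβ1 : β ≤ 1) {n p : ℕ} (hp : p < n) :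
    ∑ k ∈ range n, Real.exp (-(β * |(p : ℝ) - k|)) ≤ 4 / β := by
  set x := Real.exp (-β) with hx
  have hx0 : 0 ≤ x := (Real.exp_pos _).le
  have hx1 : x < 1 := by rw [hx, Real.exp_lt_one_iff]; linarith
  have hbound : (1 - x)⁻¹ ≤ 2 / β := by
    have h2 : x ≤ 1 - β / 2 := by
      have h3 := Real.add_one_le_exp β
      have h4 : x * Real.exp β = 1 := by rw [hx, ← Real.exp_add]; simp
      nlinarith
    rw [inv_le_comm₀ (by linarith) (by positivity), inv_div]
    linarith
  have hpow : ∀ d : ℕ, Real.exp (-(β * d)) = x ^ d := fun d => by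
    rw [hx, ← Real.exp_nat_mul]; ring_nf
  obtain ⟨m, rfl⟩ := Nat.exists_eq_add_of_lt hp
  rw [add_assoc, sum_range_add]
  have hleft : ∑ k ∈ range p, Real.exp (-(β * |(p : ℝ) - k|)) ≤ (1 - x)⁻¹ := by
    rw [← sum_range_reflect]
    refine le_trans (sum_le_sum fun k hk => ?_) (sum_pow_le_inv_one_sub hx0 hx1 p)
    rw [mem_range] at hk
    have : |(p : ℝ) - ((p - 1 - k : ℕ) : ℝ)| = ((k + 1 : ℕ) : ℝ) := by
      rw [Nat.cast_sub (by omega), Nat.cast_sub (by omega)]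
      push_cast
      rw [show (p : ℝ) - (p - 1 - k) = k + 1 by ring]
      exact abs_of_nonneg (by positivity)
    rw [this, hpow]
    exact pow_le_pow_of_le_one hx0 hx1.le (Nat.le_succ k)
  have hright : ∑ k ∈ range (m + 1), Real.exp (-(β * |(p : ℝ) - ((p + k : ℕ) : ℝ)|)) ≤
      (1 - x)⁻¹ := by
    refine le_trans (sum_le_sum fun k hk => ?_) (sum_pow_le_inv_one_sub hx0 hx1 (m + 1))
    have : |(p : ℝ) - ((p + k : ℕ) : ℝ)| = (k : ℝ) := by
      push_cast
      rw [show (p : ℝ) - (p + k) = -k by ring, abs_neg]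
      exact abs_of_nonneg (by positivity)
    rw [this, hpow]
  calc _ ≤ (1 - x)⁻¹ + (1 - x)⁻¹ := add_le_add hleft hright
    _ ≤ 2 / β + 2 / β := add_le_add hbound hbound
    _ = 4 / β := by ring

lemma sum_exp_neg_mul_abs_sub_le_div_max {β : ℝ} (hβ : 0 < β) (hβ1 : β ≤ 1) {n p : ℕ}
    (hp : p < n) :
    ∑ k ∈ range n, Real.exp (-(β * |(p : ℝ) - k|)) ≤ 4 / max β ((n : ℝ)⁻¹) := by
  rcases max_choice β ((n : ℝ)⁻¹) with h | h <;> rw [h]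
  · exact sum_exp_neg_mul_abs_sub_le hβ hβ1 hp
  · have : ∑ k ∈ range n, Real.exp (-(β * |(p : ℝ) - k|)) ≤ ∑ _k ∈ range n, (1 : ℝ) :=
      sum_le_sum fun k _ => Real.exp_le_one_iff.2 (by
        rw [neg_nonpos]; positivity)
    simp only [sum_const, card_range, nsmul_eq_mul, mul_one] at this
    rw [div_inv_eq_mul]
    linarith [show (0 : ℝ) ≤ n from n.cast_nonneg]

lemma le_card_filter_abs_sub_le {L : ℝ} (hL : 1 ≤ L) {n p : ℕ} (hLn : L ≤ n) (hp : p < n) :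
    L - 1 ≤ (#{k ∈ range n | |(p : ℝ) - (k : ℕ)| ≤ L} : ℝ) := by
  have hl : (⌊L⌋₊ : ℝ) ≤ L := Nat.floor_le (by linarith)
  have hl1 : 1 ≤ ⌊L⌋₊ := Nat.le_floor (by simpa using hL)
  have hln : ⌊L⌋₊ ≤ n := by exact_mod_cast hl.trans hLn
  have hlL : L < ⌊L⌋₊ + 1 := Nat.lt_floor_add_one L
  generalize ⌊L⌋₊ = l at *
  have hsub : Ico (min p (n - l)) (min p (n - l) + l) ⊆
      {k ∈ range n | |(p : ℝ) - (k : ℕ)| ≤ L} := by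
    intro k hk
    rw [mem_Ico] at hk
    rw [mem_filter, mem_range]
    refine ⟨by omega, le_trans ?_ hl⟩
    have h1 : p ≤ k + l := by omega
    have h2 : k ≤ p + l := by omega
    have h1' : (p : ℝ) ≤ k + l := by exact_mod_cast h1
    have h2' : (k : ℝ) ≤ p + l := by exact_mod_cast h2
    rw [abs_le]
    constructor <;> linarith
  have hcard := card_le_card hsub
  rw [Nat.card_Ico, Nat.add_sub_cancel_left] at hcard
  have : (l : ℝ) ≤ (#{k ∈ range n | |(p : ℝ) - (k : ℕ)| ≤ L} : ℝ) := by exact_mod_cast hcard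
  linarith

lemma sum_erase_erase_comp_perm_le {n : ℕ} (r : Equiv.Perm (Fin n)) (i j : Fin n) {f : ℕ → ℝ}
    (hf : ∀ k, 0 ≤ f k) :
    ∑ k ∈ (univ.erase i).erase j, f (r k) ≤ ∑ k ∈ range n, f k := by
  rw [← Fin.sum_univ_eq_sum_range, ← Equiv.sum_comp r]
  exact sum_le_sum_of_subset_of_nonneg (subset_univ _) fun k _ _ => hf _

lemma le_sum_erase_erase_comp_perm {n : ℕ} (r : Equiv.Perm (Fin n)) {i j : Fin n} (hij : i ≠ j)
    {f : ℕ → ℝ} (hf : ∀ k, f k ≤ 1) :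
    ∑ k ∈ range n, f k - 2 ≤ ∑ k ∈ (univ.erase i).erase j, f (r k) := by
  rw [← Fin.sum_univ_eq_sum_range, ← Equiv.sum_comp r,
    ← add_sum_erase univ (fun k => f (r k)) (mem_univ i),
    ← add_sum_erase (univ.erase i) (fun k => f (r k)) (mem_erase.2 ⟨hij.symm, mem_univ j⟩)]
  linarith [hf (r i), hf (r j)]

lemma regSpace.mul_abs_le {n : ℕ} {β C0 : ℝ} {θ : ℕ → ℝ} (h : regSpace n β C0 θ) {p k : ℕ}
    (hp : p < n) (hk : k < n) : β * |(p : ℝ) - k| ≤ |θ p - θ k| := by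
  by_cases hpk : p = k
  · simp [hpk]
  · exact (h.2 p k hp hk hpk).1

lemma regSpace.abs_le_mul {n : ℕ} {β C0 : ℝ} {θ : ℕ → ℝ} (h : regSpace n β C0 θ) {p k : ℕ}
    (hp : p < n) (hk : k < n) : |θ p - θ k| ≤ C0 * (β * |(p : ℝ) - k|) := by
  by_cases hpk : p = k
  · simp [hpk]
  · exact (h.2 p k hp hk hpk).2

/-- The sum of `e ^ (-|m_k|)`, with `m_k` the midpoint of `θ (r i)` and `θ (r j)` seen from
`θ (r k)`, is at most of order `1 / max β n⁻¹`. -/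
lemma sum_exp_neg_abs_midpoint_le {n : ℕ} {β C0 C : ℝ} (hβ : 0 < β) (hβ1 : β ≤ 1) {θ : ℕ → ℝ}
    (h : regSpace n β C0 θ) (r : Equiv.Perm (Fin n)) (i j : Fin n)
    (hC : |θ (r i) - θ (r j)| ≤ C) :
    ∑ k ∈ (univ.erase i).erase j,
        Real.exp (-|(θ (r i) - θ (r k) + (θ (r j) - θ (r k))) / 2|) ≤
      4 * Real.exp C / max β ((n : ℝ)⁻¹) := by
  calc _ ≤ ∑ k ∈ (univ.erase i).erase j,
        Real.exp C * Real.exp (-(β * |((r i : ℕ) : ℝ) - (r k : ℕ)|)) := by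
        refine sum_le_sum fun k _ => ?_
        rw [← Real.exp_add]
        apply Real.exp_le_exp.2
        have h1 := h.mul_abs_le (r i).2 (r k).2
        have h2 : |θ (r i) - θ (r k)| ≤ |(θ (r i) - θ (r k) + (θ (r j) - θ (r k))) / 2| +
            |(θ (r i) - θ (r j)) / 2| := by
          refine le_trans (le_of_eq ?_) (abs_add_le _ _)
          ring_nf
        rw [abs_div (θ (r i) - θ (r j)), abs_two] at h2
        linarith [abs_nonneg (θ (r i) - θ (r j))]
    _ = Real.exp C * ∑ k ∈ (univ.erase i).erase j,
        Real.exp (-(β * |((r i : ℕ) : ℝ) - (r k : ℕ)|)) := by rw [mul_sum]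
    _ ≤ Real.exp C * (4 / max β ((n : ℝ)⁻¹)) := by
        gcongr
        exact (sum_erase_erase_comp_perm_le r i j
          (f := fun k => Real.exp (-(β * |((r i : ℕ) : ℝ) - k|)))
          (fun _ => (Real.exp_pos _).le)).trans
          (sum_exp_neg_mul_abs_sub_le_div_max hβ hβ1 (r i).2)
    _ = _ := by ring

/-- The sum of `e ^ (-|m_k|)`, with `m_k` the midpoint of `θ (r i)` and `θ (r j)` seen from
`θ (r k)`, is at least of order `1 / max β n⁻¹`. -/
lemma le_sum_exp_neg_abs_midpoint {n : ℕ} {β C0 C : ℝ} (hβ : 0 < β) (hβ1 : β ≤ 1 / 6)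
    (hn : 6 ≤ n) (hC0 : 0 ≤ C0) {θ : ℕ → ℝ} (h : regSpace n β C0 θ) (r : Equiv.Perm (Fin n))
    {i j : Fin n} (hij : i ≠ j) (hC : |θ (r i) - θ (r j)| ≤ C) :
    Real.exp (-(C0 + C)) / 2 / max β ((n : ℝ)⁻¹) ≤
      ∑ k ∈ (univ.erase i).erase j,
        Real.exp (-|(θ (r i) - θ (r k) + (θ (r j) - θ (r k))) / 2|) := by
  have hn' : (6 : ℝ) ≤ n := by exact_mod_cast hn
  have hn0 : (0 : ℝ) < n := by linarith
  have hmax0 : 0 < max β ((n : ℝ)⁻¹) := lt_max_of_lt_left hβ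
  set L := (max β ((n : ℝ)⁻¹))⁻¹ with hLdef
  have hL6 : 6 ≤ L := by
    rw [hLdef, le_inv_comm₀ (by norm_num) hmax0]
    refine max_le (by linarith) ?_
    rw [inv_le_inv₀ hn0 (by norm_num)]
    exact hn'
  have hLn : L ≤ n := by
    rw [hLdef, inv_le_comm₀ hmax0 hn0]
    exact le_max_right _ _
  have hβL : β * L ≤ 1 := by
    rw [hLdef, ← div_eq_mul_inv, div_le_one hmax0]
    exact le_max_left _ _
  set f : ℕ → ℝ := fun k => if |((r i : ℕ) : ℝ) - k| ≤ L then 1 else 0 with hf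
  have hfsum : L - 1 ≤ ∑ k ∈ range n, f k := by
    rw [hf, sum_boole]
    exact le_card_filter_abs_sub_le (by linarith) hLn (r i).2
  have hfle := le_sum_erase_erase_comp_perm r hij (f := f) (fun k => by
    simp only [hf]; split_ifs <;> norm_num)
  calc Real.exp (-(C0 + C)) / 2 / max β ((n : ℝ)⁻¹) = Real.exp (-(C0 + C)) * (L / 2) := by
        rw [hLdef]; ring
    _ ≤ Real.exp (-(C0 + C)) * ∑ k ∈ (univ.erase i).erase j, f (r k) := by
        gcongr
        linarith
    _ = ∑ k ∈ (univ.erase i).erase j, Real.exp (-(C0 + C)) * f (r k) := by rw [mul_sum]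
    _ ≤ _ := by
        refine sum_le_sum fun k _ => ?_
        simp only [hf]
        split_ifs with hk
        · rw [mul_one]
          apply Real.exp_le_exp.2
          have h1 := h.abs_le_mul (r i).2 (r k).2
          have h2 : |(θ (r i) - θ (r k) + (θ (r j) - θ (r k))) / 2| ≤ |θ (r i) - θ (r k)| +
              |(θ (r i) - θ (r j)) / 2| := by
            refine le_trans (le_of_eq ?_) (abs_sub _ _)
            ring_nf
          have h3 : C0 * (β * |((r i : ℕ) : ℝ) - (r k : ℕ)|) ≤ C0 * 1 := by
            gcongr
            exact (mul_le_mul_of_nonneg_left hk hβ.le).trans hβL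
          rw [abs_div (θ (r i) - θ (r j)), abs_two] at h2
          linarith [abs_nonneg (θ (r i) - θ (r j))]
        · rw [mul_zero]
          positivity

/-- **Lemma 7.8**: deterministic properties of the function G. -/
theorem G_properties
    (C0 : ℝ) (hC0 : 1 ≤ C0)
    (β : ℕ → ℝ) (hβpos : ∀ n, 0 < β n) (hβ0 : Tendsto β atTop (nhds 0))
    (C : ℝ) (hC : 0 < C) :
    ∃ C1 C2 C3 : ℝ, 0 < C1 ∧ 0 < C2 ∧ 0 < C3 ∧ ∃ N : ℕ, ∀ n : ℕ, N ≤ n →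
      ∀ θ : ℕ → ℝ, regSpace n (β n) C0 θ →
      ∀ r : Equiv.Perm (Fin n), ∀ i j : Fin n, i ≠ j →
        |θ ((r i : ℕ)) - θ ((r j : ℕ))| ≤ C →
        -- (a)
        (∀ u ∈ Set.Icc (0 : ℝ) 1, ∀ k ∈ (Finset.univ.erase i).erase j,
          Gfun n θ r i j k u ≤ C1) ∧
        -- (b)
        (∀ u ∈ Set.Icc (0 : ℝ) 1,
          ∑ k ∈ (Finset.univ.erase i).erase j,
              (Gfun n θ r i j k u + Gfun n θ r i j k (1 - u))
            ≤ ∑ k ∈ (Finset.univ.erase i).erase j, logRatio n θ r i j k) ∧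
        -- (c)
        (∀ u ∈ Set.Icc (0 : ℝ) 1,
          ∑ k ∈ (Finset.univ.erase i).erase j,
              ((Gfun n θ r i j k u) ^ 2 + (Gfun n θ r i j k (1 - u)) ^ 2)
            ≤ C2 * (θ ((r i : ℕ)) - θ ((r j : ℕ))) ^ 4 / max (β n) ((n : ℝ)⁻¹)) ∧
        -- (d)
        (C3 * |θ ((r i : ℕ)) - θ ((r j : ℕ))| ^ 2 / max (β n) ((n : ℝ)⁻¹)
            ≤ ∑ k ∈ (Finset.univ.erase i).erase j, logRatio n θ r i j k ∧
          ∑ k ∈ (Finset.univ.erase i).erase j, logRatio n θ r i j k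
            ≤ C2 * |θ ((r i : ℕ)) - θ ((r j : ℕ))| ^ 2 / max (β n) ((n : ℝ)⁻¹)) := by
  have hK : 0 < 16 * (4 * (1 + Real.exp C * C ^ 2)) := by positivity
  have hexp : 1 ≤ Real.exp C := Real.one_le_exp hC.le
  obtain ⟨N, hN⟩ := eventually_atTop.1
    (hβ0.eventually_le_const (show (0 : ℝ) < 1 / 6 by norm_num))
  refine ⟨C, Real.exp C ^ 2 * (4 * Real.exp C),
    Real.exp (-(C0 + C)) / 2 / (16 * (4 * (1 + Real.exp C * C ^ 2))), hC, by positivity,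
    by positivity, max N 6, ?_⟩
  intro n hn θ hθ r i j hij hδ
  have hβn := hβpos n
  have hβ6 : β n ≤ 1 / 6 := hN n ((le_max_left _ _).trans hn)
  have hmax0 : 0 < max (β n) ((n : ℝ)⁻¹) := lt_max_of_lt_left hβn
  have hup := sum_exp_neg_abs_midpoint_le hβn (by linarith) hθ r i j hδ
  have hlo := le_sum_exp_neg_abs_midpoint hβn hβ6 ((le_max_right _ _).trans hn) (by linarith)
    hθ r hij hδ
  have hsub : ∀ k, θ (r i) - θ (r k) - (θ (r j) - θ (r k)) = θ (r i) - θ (r j) := fun k => by ring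
  have hterm_le : ∀ k, logRatio n θ r i j k ≤ Real.exp C * (θ (r i) - θ (r j)) ^ 2 *
      Real.exp (-|(θ (r i) - θ (r k) + (θ (r j) - θ (r k))) / 2|) := fun k => by
    have := softplus_gap_le (a := θ (r i) - θ (r k)) (b := θ (r j) - θ (r k)) (C := C)
      (by rwa [hsub])
    rwa [hsub, ← logRatio_eq] at this
  have hle_term : ∀ k, (θ (r i) - θ (r j)) ^ 2 / (16 * (4 * (1 + Real.exp C * C ^ 2))) *
      Real.exp (-|(θ (r i) - θ (r k) + (θ (r j) - θ (r k))) / 2|) ≤ logRatio n θ r i j k :=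
    fun k => by
      have := le_softplus_gap (a := θ (r i) - θ (r k)) (b := θ (r j) - θ (r k)) (C := C)
        (by rwa [hsub])
      rwa [hsub, ← logRatio_eq, mul_div_right_comm] at this
  refine ⟨fun u hu k _ => (Gfun_le_abs_sub n θ r i j k hu).trans hδ,
    fun u _ => sum_le_sum fun k _ => Gfun_add_Gfun_one_sub_le n θ r i j k u, fun u hu => ?_,
    ?_, ?_⟩
  · calc _ ≤ ∑ k ∈ (univ.erase i).erase j, (Real.exp C * (θ (r i) - θ (r j)) ^ 2) ^ 2 *
          Real.exp (-|(θ (r i) - θ (r k) + (θ (r j) - θ (r k))) / 2|) := by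
          refine sum_le_sum fun k _ => (Gfun_sq_add_sq_le n θ r i j k hu).trans ?_
          have hE : Real.exp (-|(θ (r i) - θ (r k) + (θ (r j) - θ (r k))) / 2|) ≤ 1 :=
            Real.exp_le_one_iff.2 (by simp)
          refine (pow_le_pow_left₀ (logRatio_nonneg n θ r i j k) (hterm_le k) 2).trans ?_
          rw [mul_pow]
          gcongr
          exact pow_le_of_le_one (Real.exp_pos _).le hE two_ne_zero
      _ = (Real.exp C * (θ (r i) - θ (r j)) ^ 2) ^ 2 * ∑ k ∈ (univ.erase i).erase j,
          Real.exp (-|(θ (r i) - θ (r k) + (θ (r j) - θ (r k))) / 2|) := by rw [mul_sum]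
      _ ≤ (Real.exp C * (θ (r i) - θ (r j)) ^ 2) ^ 2 *
          (4 * Real.exp C / max (β n) ((n : ℝ)⁻¹)) := by gcongr
      _ = _ := by ring
  · rw [sq_abs]
    calc _ = (θ (r i) - θ (r j)) ^ 2 / (16 * (4 * (1 + Real.exp C * C ^ 2))) *
          (Real.exp (-(C0 + C)) / 2 / max (β n) ((n : ℝ)⁻¹)) := by ring
      _ ≤ (θ (r i) - θ (r j)) ^ 2 / (16 * (4 * (1 + Real.exp C * C ^ 2))) *
          ∑ k ∈ (univ.erase i).erase j,
            Real.exp (-|(θ (r i) - θ (r k) + (θ (r j) - θ (r k))) / 2|) := by gcongr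
      _ ≤ _ := by
          rw [mul_sum]
          exact sum_le_sum fun k _ => hle_term k
  · rw [sq_abs]
    calc _ ≤ ∑ k ∈ (univ.erase i).erase j, Real.exp C * (θ (r i) - θ (r j)) ^ 2 *
          Real.exp (-|(θ (r i) - θ (r k) + (θ (r j) - θ (r k))) / 2|) :=
          sum_le_sum fun k _ => hterm_le k
      _ = Real.exp C * (θ (r i) - θ (r j)) ^ 2 * ∑ k ∈ (univ.erase i).erase j,
          Real.exp (-|(θ (r i) - θ (r k) + (θ (r j) - θ (r k))) / 2|) := by rw [mul_sum]
      _ ≤ Real.exp C * (θ (r i) - θ (r j)) ^ 2 *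
          (4 * Real.exp C / max (β n) ((n : ℝ)⁻¹)) := by gcongr
      _ ≤ Real.exp C ^ 2 * (θ (r i) - θ (r j)) ^ 2 *
          (4 * Real.exp C / max (β n) ((n : ℝ)⁻¹)) := by
          gcongr
          exact le_self_pow₀ hexp two_ne_zero
      _ = _ := by ring

end
end
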